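/- Let p be an odd prime and let S = F_p[X]/(X³ − X), with v denoting the image of X in S. The six ring automorphisms θ₁, …, θ₆ of S determined by θ₁(v) = v, θ₂(v) = −v, θ₃(v) = 1 − (1/2)v − (3/2)v², θ₄(v) = 1 + (1/2)v − (3/2)v², θ₅(v) = −1 + (1/2)v + (3/2)v², θ₆(v) = −1 − (1/2)v + (3/2)v² are pairwise distinct, and every ring automorphism of S equals one of them. -/

import Mathlib

open Polynomial

/-- `S p` is the ring `F_p[X]/(X³ - X)`. -/
noncomputable abbrev S (p : ℕ) : Type := AdjoinRoot (X ^ 3 - X : (ZMod p)[X])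

/-- `v p` is the image of `X` in `S p`. -/
noncomputable abbrev v (p : ℕ) : S p := AdjoinRoot.root _

/-- The canonical embedding of `F_p` into `S p`. -/
noncomputable abbrev ofFp (p : ℕ) : ZMod p →+* S p := AdjoinRoot.of _

/-- The element `a + b·v + c·v²` of `S p`. -/
noncomputable def el (p : ℕ) (a b c : ZMod p) : S p :=
  ofFp p a + ofFp p b * v p + ofFp p c * (v p) ^ 2

theorem v_cube (p : ℕ) : v p ^ 3 = v p := by
  have h := AdjoinRoot.eval₂_root (X ^ 3 - X : (ZMod p)[X])
  simpa [sub_eq_zero] using h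

/-- The ring homomorphism from `S p` sending `v p` to a given `x` with `x ^ 3 = x`. -/
noncomputable def liftCube {p : ℕ} {R : Type*} [CommRing R] (i : ZMod p →+* R) (x : R)
    (hx : x ^ 3 = x) : S p →+* R :=
  AdjoinRoot.lift i x (by simp [hx])

@[simp]
theorem liftCube_v {p : ℕ} {R : Type*} [CommRing R] (i : ZMod p →+* R) (x : R)
    (hx : x ^ 3 = x) : liftCube i x hx (v p) = x := by
  simp [liftCube]

@[simp]
theorem liftCube_ofFp {p : ℕ} {R : Type*} [CommRing R] (i : ZMod p →+* R) (x : R)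
    (hx : x ^ 3 = x) (a : ZMod p) : liftCube i x hx (ofFp p a) = i a := by
  simp [liftCube]

theorem ringHom_ext_v {p : ℕ} {R : Type*} [CommRing R] {f g : S p →+* R}
    (h : f (v p) = g (v p)) : f = g :=
  AdjoinRoot.ringHom_ext (Subsingleton.elim _ _) h

/-- Evaluation at a point `a` of `F_p` with `a ^ 3 = a`. -/
noncomputable abbrev ev {p : ℕ} (a : ZMod p) (ha : a ^ 3 = a) : S p →+* ZMod p :=
  liftCube (RingHom.id _) a ha

@[simp]
theorem ev_el {p : ℕ} (x : ZMod p) (hx : x ^ 3 = x) (a b c : ZMod p) :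
    ev x hx (el p a b c) = a + b * x + c * x ^ 2 := by
  simp only [el, map_add, map_mul, map_pow, liftCube_v, liftCube_ofFp, RingHom.id_apply]

/-- The values of an element of `S p` at `0`, `1` and `-1`. -/
noncomputable def values (p : ℕ) (s : S p) : ZMod p × ZMod p × ZMod p :=
  (ev 0 (by ring) s, ev 1 (by ring) s, ev (-1) (by ring) s)

theorem two_mul_eq_interpolation {p : ℕ} (s : S p) :
    2 * s = ofFp p (ev 0 (by ring) s) * (2 * (1 - v p ^ 2)) +
      ofFp p (ev 1 (by ring) s) * (v p ^ 2 + v p) +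
      ofFp p (ev (-1) (by ring) s) * (v p ^ 2 - v p) := by
  have hv := v_cube p
  induction s using AdjoinRoot.induction_on with
  | ih f =>
    induction f using Polynomial.induction_on with
    | C a =>
      change 2 * ofFp p a = ofFp p (ev 0 _ (ofFp p a)) * _ + ofFp p (ev 1 _ (ofFp p a)) * _ +
        ofFp p (ev (-1) _ (ofFp p a)) * _
      simp only [liftCube_ofFp, RingHom.id_apply]
      ring
    | add f g hf hg =>
      simp only [map_add, mul_add, add_mul, hf, hg]
      ring
    | monomial n a h =>
      have e : AdjoinRoot.mk (X ^ 3 - X : (ZMod p)[X]) (C a * X ^ (n + 1)) =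
          AdjoinRoot.mk (X ^ 3 - X : (ZMod p)[X]) (C a * X ^ n) * v p := by
        rw [v, ← AdjoinRoot.mk_X, ← map_mul, mul_assoc, ← pow_succ]
      rw [e, ← mul_assoc, h]
      generalize AdjoinRoot.mk (X ^ 3 - X : (ZMod p)[X]) (C a * X ^ n) = r
      simp only [map_mul, liftCube_v, map_zero, map_one, map_neg]
      generalize ofFp p (ev 0 _ _) = A
      generalize ofFp p (ev 1 _ _) = B
      generalize ofFp p (ev (-1) _ _) = D
      linear_combination (-2 * A + B + D) * hv

theorem two_ne_zero_of_odd {p : ℕ} [Fact p.Prime] (hodd : Odd p) : (2 : ZMod p) ≠ 0 := by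
  have : Fact (2 < p) := ⟨by
    have := (Fact.out : p.Prime).two_le
    obtain ⟨k, rfl⟩ := hodd
    omega⟩
  have h := ZMod.neg_one_ne_one (n := p)
  intro h2
  exact h (by linear_combination -h2)

theorem values_injective {p : ℕ} [Fact p.Prime] (h2 : (2 : ZMod p) ≠ 0) :
    Function.Injective (values p) := by
  intro s t h
  simp only [values, Prod.mk.injEq] at h
  have hu : ofFp p 2⁻¹ * 2 = 1 := by
    rw [← map_ofNat (ofFp p) 2, ← map_mul, inv_mul_cancel₀ h2, map_one]
  have hst : 2 * s = 2 * t := by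
    rw [two_mul_eq_interpolation s, two_mul_eq_interpolation t, h.1, h.2.1, h.2.2]
  linear_combination ofFp p 2⁻¹ * hst + (t - s) * hu

theorem values_automorphism_injective {p : ℕ} [Fact p.Prime] (h2 : (2 : ZMod p) ≠ 0) :
    Function.Injective fun θ : S p ≃+* S p => values p (θ (v p)) := by
  intro θ η h
  have := ringHom_ext_v (f := (θ : S p →+* S p)) (g := (η : S p →+* S p))
    (values_injective h2 h)
  exact RingEquiv.ext fun s => RingHom.congr_fun this s

theorem ev_automorphism_injective {p : ℕ} (θ : S p ≃+* S p) {a b : ZMod p} (ha : a ^ 3 = a)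
    (hb : b ^ 3 = b) (h : ev a ha (θ (v p)) = ev b hb (θ (v p))) : a = b := by
  have e := ringHom_ext_v (f := (ev a ha).comp (θ : S p →+* S p))
    (g := (ev b hb).comp (θ : S p →+* S p)) h
  have := RingHom.congr_fun e (θ.symm (v p))
  simpa using this

theorem ev_v_cases {p : ℕ} [Fact p.Prime] (θ : S p ≃+* S p) {a : ZMod p} (ha : a ^ 3 = a) :
    ev a ha (θ (v p)) = 0 ∨ ev a ha (θ (v p)) = 1 ∨ ev a ha (θ (v p)) = -1 := by
  have h : ev a ha (θ (v p)) ^ 3 = ev a ha (θ (v p)) := by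
    rw [← map_pow, ← map_pow, v_cube]
  generalize ev a ha (θ (v p)) = x at h
  have : x * ((x - 1) * (x + 1)) = 0 := by linear_combination h
  simpa [sub_eq_zero, add_eq_zero_iff_eq_neg] using this

/-- The automorphism of `S p` sending `v p` to `x`, with inverse sending `v p` to `y`. -/
noncomputable def autOfInverse {p : ℕ} (x y : S p) (hx : x ^ 3 = x) (hy : y ^ 3 = y)
    (hxy : liftCube (ofFp p) x hx y = v p) (hyx : liftCube (ofFp p) y hy x = v p) :
    S p ≃+* S p :=
  RingEquiv.ofRingHom (liftCube (ofFp p) x hx) (liftCube (ofFp p) y hy)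
    (ringHom_ext_v (by simpa using hxy)) (ringHom_ext_v (by simpa using hyx))

theorem values_el {p : ℕ} (a b c : ZMod p) :
    values p (el p a b c) = (a, a + b + c, a - b + c) := by
  simp only [values, ev_el, Prod.mk.injEq]
  refine ⟨?_, ?_, ?_⟩ <;> ring

theorem v_eq_el (p : ℕ) : v p = el p 0 1 0 := by simp [el]

theorem neg_v_eq_el (p : ℕ) : -v p = el p 0 (-1) 0 := by simp [el]

theorem values_liftCube_el {p : ℕ} (x : S p) (hx : x ^ 3 = x) (a b c : ZMod p) :
    values p (liftCube (ofFp p) x hx (el p a b c)) =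
      (a + b * (values p x).1 + c * (values p x).1 ^ 2,
        a + b * (values p x).2.1 + c * (values p x).2.1 ^ 2,
        a + b * (values p x).2.2 + c * (values p x).2.2 ^ 2) := by
  simp only [values, el, map_add, map_mul, map_pow, liftCube_v, liftCube_ofFp, RingHom.id_apply]

theorem exists_automorphism {p : ℕ} [Fact p.Prime] (h2 : (2 : ZMod p) ≠ 0)
    {a b c a' b' c' : ZMod p} (x y z x' y' z' : ZMod p)
    (hx : values p (el p a b c) = (x, y, z)) (hy : values p (el p a' b' c') = (x', y', z'))
    (h : x ^ 3 = x ∧ y ^ 3 = y ∧ z ^ 3 = z) (h' : x' ^ 3 = x' ∧ y' ^ 3 = y' ∧ z' ^ 3 = z')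
    (hxy : a' + b' * x + c' * x ^ 2 = 0 ∧ a' + b' * y + c' * y ^ 2 = 1 ∧
      a' + b' * z + c' * z ^ 2 = -1)
    (hyx : a + b * x' + c * x' ^ 2 = 0 ∧ a + b * y' + c * y' ^ 2 = 1 ∧
      a + b * z' + c * z' ^ 2 = -1) :
    ∃ θ : S p ≃+* S p, θ (v p) = el p a b c := by
  have hv : values p (v p) = (0, 1, -1) := by rw [v_eq_el, values_el]; simp
  have cube {s : S p} {x y z : ZMod p} (hs : values p s = (x, y, z))
      (h : x ^ 3 = x ∧ y ^ 3 = y ∧ z ^ 3 = z) : s ^ 3 = s := by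
    apply values_injective h2
    simp only [values, Prod.mk.injEq] at hs
    simp only [values, map_pow, hs, h]
  refine ⟨autOfInverse (el p a b c) (el p a' b' c') (cube hx h) (cube hy h')
    (values_injective h2 ?_) (values_injective h2 ?_), ?_⟩
  · rw [values_liftCube_el, hx, hv, hxy.1, hxy.2.1, hxy.2.2]
  · rw [values_liftCube_el, hy, hv, hyx.1, hyx.2.1, hyx.2.2]
  · exact liftCube_v _ _ (cube hx h)

theorem six_automorphisms (p : ℕ) (hp : p.Prime) (hodd : Odd p) :
    ∃ θ₁ θ₂ θ₃ θ₄ θ₅ θ₆ : S p ≃+* S p,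
      θ₁ (v p) = v p ∧
      θ₂ (v p) = -v p ∧
      θ₃ (v p) = el p 1 (-(2⁻¹ : ZMod p)) (-(3 * 2⁻¹)) ∧
      θ₄ (v p) = el p 1 (2⁻¹ : ZMod p) (-(3 * 2⁻¹)) ∧
      θ₅ (v p) = el p (-1) (2⁻¹ : ZMod p) (3 * 2⁻¹) ∧
      θ₆ (v p) = el p (-1) (-(2⁻¹ : ZMod p)) (3 * 2⁻¹) ∧
      ([θ₁, θ₂, θ₃, θ₄, θ₅, θ₆] : List (S p ≃+* S p)).Nodup ∧
      ∀ θ : S p ≃+* S p, θ ∈ ([θ₁, θ₂, θ₃, θ₄, θ₅, θ₆] : List (S p ≃+* S p)) := by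
  have : Fact p.Prime := ⟨hp⟩
  have h2 := two_ne_zero_of_odd hodd
  have hn : (1 : ZMod p) ≠ -1 := fun h => h2 (by linear_combination h)
  have hu : (2 : ZMod p) * 2⁻¹ = 1 := mul_inv_cancel₀ h2
  have e₁ : values p (v p) = (0, 1, -1) := by rw [v_eq_el, values_el]; simp
  have e₂ : values p (-v p) = (0, -1, 1) := by rw [neg_v_eq_el, values_el]; simp
  have e₃ : values p (el p 1 (-(2⁻¹ : ZMod p)) (-(3 * 2⁻¹))) = (1, -1, 0) := by
    rw [values_el, Prod.mk.injEq, Prod.mk.injEq]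
    exact ⟨rfl, by linear_combination -2 * hu, by linear_combination -hu⟩
  have e₄ : values p (el p 1 (2⁻¹ : ZMod p) (-(3 * 2⁻¹))) = (1, 0, -1) := by
    rw [values_el, Prod.mk.injEq, Prod.mk.injEq]
    exact ⟨rfl, by linear_combination -hu, by linear_combination -2 * hu⟩
  have e₅ : values p (el p (-1) (2⁻¹ : ZMod p) (3 * 2⁻¹)) = (-1, 1, 0) := by
    rw [values_el, Prod.mk.injEq, Prod.mk.injEq]
    exact ⟨rfl, by linear_combination 2 * hu, by linear_combination hu⟩
  have e₆ : values p (el p (-1) (-(2⁻¹ : ZMod p)) (3 * 2⁻¹)) = (-1, 0, 1) := by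
    rw [values_el, Prod.mk.injEq, Prod.mk.injEq]
    exact ⟨rfl, by linear_combination hu, by linear_combination 2 * hu⟩
  obtain ⟨θ₂, h₂⟩ : ∃ θ : S p ≃+* S p, θ (v p) = -v p := by
    rw [neg_v_eq_el] at e₂ ⊢
    exact exists_automorphism h2 _ _ _ _ _ _ e₂ e₂ (by ring_nf; simp) (by ring_nf; simp)
      (by simp) (by simp)
  obtain ⟨θ₃, h₃⟩ := exists_automorphism h2 _ _ _ _ _ _ e₃ e₆ (by ring_nf; simp)
    (by ring_nf; simp) (by grind) (by grind)
  obtain ⟨θ₄, h₄⟩ := exists_automorphism h2 _ _ _ _ _ _ e₄ e₄ (by ring_nf; simp)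
    (by ring_nf; simp) (by grind) (by grind)
  obtain ⟨θ₅, h₅⟩ := exists_automorphism h2 _ _ _ _ _ _ e₅ e₅ (by ring_nf; simp)
    (by ring_nf; simp) (by grind) (by grind)
  obtain ⟨θ₆, h₆⟩ := exists_automorphism h2 _ _ _ _ _ _ e₆ e₃ (by ring_nf; simp)
    (by ring_nf; simp) (by grind) (by grind)
  refine ⟨RingEquiv.refl _, θ₂, θ₃, θ₄, θ₅, θ₆, rfl, h₂, h₃, h₄, h₅, h₆, ?_, fun θ => ?_⟩
  · apply List.Nodup.of_map fun θ : S p ≃+* S p => values p (θ (v p))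
    simp only [List.map_cons, List.map_nil, RingEquiv.refl_apply, h₂, h₃, h₄, h₅, h₆,
      e₁, e₂, e₃, e₄, e₅, e₆]
    simp [hn, hn.symm]
  · rw [← List.mem_map_of_injective (values_automorphism_injective h2)]
    simp only [List.map_cons, List.map_nil, RingEquiv.refl_apply, h₂, h₃, h₄, h₅, h₆,
      e₁, e₂, e₃, e₄, e₅, e₆]
    have h01 := mt (ev_automorphism_injective θ (a := 0) (b := 1) (by ring) (by ring)) (by simp)
    have h0n := mt (ev_automorphism_injective θ (a := 0) (b := -1) (by ring) (by ring)) (by simp)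
    have h1n := mt (ev_automorphism_injective θ (a := 1) (b := -1) (by ring) (by ring)) hn
    rw [values]
    rcases ev_v_cases θ (a := 0) (by ring) with h | h | h <;>
    rcases ev_v_cases θ (a := 1) (by ring) with h' | h' | h' <;>
    rcases ev_v_cases θ (a := -1) (by ring) with h'' | h'' | h'' <;>
    simp_all
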